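/- As z → +∞ along the positive reals, E(z; 1, 1/2) = −1 − (π·log z)^{−1/2} + O((log z)^{−3/2}) and E(z; −1, 1/2) = −1 + (π·log z)^{−1/2} + O((log z)^{−3/2}). -/

import Mathlib

open MeasureTheory Filter Asymptotics

noncomputable def FF (c w : ℂ) : ℂ :=
  Complex.exp (c * w ^ (1 / 2 : ℂ)) * ((Real.pi : ℂ) / Complex.sin (Real.pi * w))

lemma norm_sin_ge (w : ℂ) : Real.sinh |w.im| ≤ ‖Complex.sin w‖ := by
  have h1 : Complex.sin w = (Complex.exp (-w * Complex.I) - Complex.exp (w * Complex.I)) * Complex.I / 2 := rfl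
  rw [h1, norm_div, norm_mul, Complex.norm_I, mul_one]
  have h2 : ‖Complex.exp (-w * Complex.I)‖ = Real.exp w.im := by
    rw [Complex.norm_exp]; simp
  have h3 : ‖Complex.exp (w * Complex.I)‖ = Real.exp (-w.im) := by
    rw [Complex.norm_exp]; simp
  have h4 := abs_norm_sub_norm_le (Complex.exp (-w * Complex.I)) (Complex.exp (w * Complex.I))
  rw [h2, h3] at h4
  have h5 : Real.sinh |w.im| = |Real.exp w.im - Real.exp (-w.im)| / 2 := by
    rw [Real.sinh_eq]
    rcases abs_cases w.im with ⟨h, h'⟩ | ⟨h, h'⟩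
    · rw [h, abs_of_nonneg]
      have := Real.exp_le_exp.mpr (show -w.im ≤ w.im by linarith)
      linarith
    · rw [h, abs_of_nonpos]
      · ring_nf
      have := Real.exp_le_exp.mpr (show w.im ≤ -w.im by linarith)
      linarith
  rw [h5]
  simp only [Complex.norm_ofNat]
  linarith

lemma sinh_ge {x : ℝ} (hx : 3 / 20 ≤ x) : Real.exp x / 10 ≤ Real.sinh x := by
  rw [Real.sinh_eq]
  have h1 : Real.exp (-x) * Real.exp x = 1 := by rw [← Real.exp_add]; simp
  have h2 := Real.add_one_le_exp x
  have h3 := Real.exp_pos (-x)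
  have h4 : 1.3 ≤ Real.exp x * Real.exp x := by
    rw [← Real.exp_add]
    have := Real.add_one_le_exp (x + x)
    linarith
  have h5 := Real.exp_pos x
  have : Real.exp (-x) * 1.3 ≤ Real.exp x := by
    calc Real.exp (-x) * 1.3 ≤ Real.exp (-x) * (Real.exp x * Real.exp x) := by gcongr
      _ = Real.exp x := by rw [← mul_assoc, h1, one_mul]
  linarith

lemma norm_sqrt (w : ℂ) : ‖w ^ (1 / 2 : ℂ)‖ = ‖w‖ ^ (1 / 2 : ℝ) := by
  have := Complex.norm_cpow_real w (1 / 2)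
  rw [← this]; norm_num

lemma FF_far {c w : ℂ} (hc : ‖c‖ ≤ 1) (hre : |w.re| ≤ 1) (him : 1 / 20 ≤ |w.im|) :
    ‖FF c w‖ ≤ (20 * Real.pi * Real.exp 2) / (1 + w.im ^ 2) := by
  have hpi := Real.pi_gt_three
  have hnw : ‖w‖ ≤ 1 + |w.im| := (Complex.norm_le_abs_re_add_abs_im w).trans (by linarith)
  have hs : ‖w‖ ^ (1 / 2 : ℝ) ≤ 2 + |w.im| := by
    rw [← Real.sqrt_eq_rpow]
    apply Real.sqrt_le_iff.mpr
    constructor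
    · positivity
    · nlinarith [abs_nonneg w.im]
  have h1 : ‖Complex.exp (c * w ^ (1 / 2 : ℂ))‖ ≤ Real.exp (2 + |w.im|) := by
    refine (Complex.norm_exp_le_exp_norm _).trans (Real.exp_le_exp.mpr ?_)
    rw [norm_mul, norm_sqrt]
    calc ‖c‖ * ‖w‖ ^ (1 / 2 : ℝ) ≤ 1 * ‖w‖ ^ (1 / 2 : ℝ) := by gcongr
      _ ≤ _ := by linarith
  have h2 : Real.exp (3 * |w.im|) / 10 ≤ ‖Complex.sin (Real.pi * w)‖ := by
    refine le_trans ?_ (norm_sin_ge _)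
    have : |(Real.pi * w).im| = Real.pi * |w.im| := by
      simp [abs_mul, abs_of_pos Real.pi_pos]
    rw [this]
    refine le_trans ?_ (sinh_ge (by nlinarith))
    gcongr
  have h3 : 1 + w.im ^ 2 ≤ 2 * Real.exp |w.im| := by
    have := Real.quadratic_le_exp_of_nonneg (abs_nonneg w.im)
    rw [sq_abs] at this
    nlinarith [abs_nonneg w.im]
  rw [FF, norm_mul, norm_div, le_div_iff₀ (by positivity)]
  have h4 : ‖(Real.pi : ℂ)‖ = Real.pi := by simp [abs_of_pos Real.pi_pos]
  rw [h4]
  have h5 : 0 < Real.exp (3 * |w.im|) / 10 := by positivity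
  calc _ ≤ Real.exp (2 + |w.im|) * (Real.pi / (Real.exp (3 * |w.im|) / 10)) * (2 * Real.exp |w.im|) := by
        gcongr
    _ = 20 * Real.pi * Real.exp 2 * (Real.exp |w.im| * Real.exp |w.im| / Real.exp (3 * |w.im|)) := by
        rw [Real.exp_add]; field_simp; ring
    _ ≤ 20 * Real.pi * Real.exp 2 * 1 := by
        gcongr
        rw [← Real.exp_add, div_le_one (by positivity)]
        apply Real.exp_le_exp.mpr
        linarith [abs_nonneg w.im]
    _ = _ := by ring

noncomputable def QQ (c w : ℂ) : ℂ := FF c w - w ^ (-1 : ℂ) - c * w ^ (-(1 / 2) : ℂ) - c ^ 2 / 2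

lemma csc_near {w : ℂ} (hw0 : w ≠ 0) (hw : ‖w‖ ≤ 1 / 4) :
    ‖(Real.pi : ℂ) / Complex.sin (Real.pi * w) - 1 / w‖ ≤ 8 * ‖w‖ := by
  have hpi := Real.pi_gt_three
  have hpi4 := Real.pi_lt_d2
  have h4 : ‖(Real.pi : ℂ)‖ = Real.pi := by simp [abs_of_pos Real.pi_pos]
  set x : ℂ := Real.pi * w with hx
  have hxn : ‖x‖ = Real.pi * ‖w‖ := by rw [hx, norm_mul, h4]
  have hx0 : 0 < ‖x‖ := by rw [hxn]; have := norm_pos_iff.mpr hw0; positivity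
  have hx1 : ‖x‖ ≤ 1 := by rw [hxn]; nlinarith
  have hb := Complex.sin_bound hx1
  have hb2 : ‖Complex.sin x - x‖ ≤ ‖x‖ ^ 3 / 4 := by
    have : Complex.sin x - x = (Complex.sin x - (x - x ^ 3 / 6)) + - (x ^ 3 / 6) := by ring
    rw [this]
    refine (norm_add_le _ _).trans ?_
    rw [norm_neg, norm_div, norm_pow]
    have h6 : ‖(6 : ℂ)‖ = 6 := by simp
    rw [h6]
    have : ‖x‖ ^ 5 ≤ ‖x‖ ^ 3 := pow_le_pow_of_le_one hx0.le hx1 (by norm_num)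
    have : 0 < ‖x‖ ^ 3 := by positivity
    linarith
  have hb3 : ‖x‖ / 2 ≤ ‖Complex.sin x‖ := by
    have h1 := norm_sub_norm_le x (x - Complex.sin x)
    rw [sub_sub_cancel, norm_sub_rev] at h1
    have : ‖x‖ ^ 3 ≤ ‖x‖ ^ 1 := pow_le_pow_of_le_one hx0.le hx1 (by norm_num)
    linarith
  have hs0 : Complex.sin x ≠ 0 := by
    intro h; rw [h, norm_zero] at hb3; linarith
  have hw' := norm_pos_iff.mpr hw0
  have : (Real.pi : ℂ) / Complex.sin x - 1 / w = -(Complex.sin x - x) / (Complex.sin x * w) := by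
    rw [hx]; rw [hx] at hs0; field_simp; ring
  rw [this, norm_div, norm_neg, norm_mul, div_le_iff₀ (by positivity)]
  calc ‖Complex.sin x - x‖ ≤ ‖x‖ ^ 3 / 4 := hb2
    _ = ‖x‖ * (Real.pi ^ 2 * ‖w‖ ^ 2 / 4) := by rw [hxn]; ring
    _ ≤ ‖x‖ * (16 * ‖w‖ ^ 2 / 4) := by
        have : Real.pi ^ 2 ≤ 16 := by nlinarith
        gcongr
    _ = 8 * ‖w‖ * (‖x‖ / 2 * ‖w‖) := by ring
    _ ≤ _ := by gcongr

lemma QQ_near {c w : ℂ} (hc : ‖c‖ ≤ 1) (hw0 : w ≠ 0) (hw : ‖w‖ ≤ 1 / 4) :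
    ‖QQ c w‖ ≤ 100 * ‖w‖ ^ (1 / 2 : ℝ) := by
  have hcsc := csc_near hw0 hw
  set h := (Real.pi : ℂ) / Complex.sin (Real.pi * w) - 1 / w with hh
  set s := w ^ (1 / 2 : ℂ) with hs
  have hs2 : s ^ 2 = w := by
    rw [hs, ← Complex.cpow_nat_mul]; norm_num
  have hs0 : s ≠ 0 := by
    intro h0; rw [h0] at hs2; apply hw0; rw [← hs2]; simp
  have hsn : ‖s‖ = ‖w‖ ^ (1 / 2 : ℝ) := norm_sqrt w
  have hwn : ‖w‖ = ‖s‖ ^ 2 := by rw [← hs2, norm_pow]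
  rw [← hsn]
  have hsp := norm_pos_iff.mpr hs0
  have hs1 : ‖s‖ ≤ 1 / 2 := by
    rw [hwn] at hw; nlinarith
  have hinv : w ^ (-(1 / 2) : ℂ) = s⁻¹ := Complex.cpow_neg _ _
  have hcs : ‖c * s‖ ≤ ‖s‖ := by rw [norm_mul]; nlinarith
  have he := Complex.exp_bound (hcs.trans (by linarith : ‖s‖ ≤ 1)) (n := 3) (by norm_num)
  simp only [Finset.sum_range_succ, Finset.sum_range_zero] at he
  norm_num [Nat.factorial] at he
  set e := Complex.exp (c * s) - (1 + c * s + (c * s) ^ 2 / 2) with hee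
  have he' : ‖e‖ ≤ ‖s‖ ^ 3 := by
    calc ‖e‖ ≤ _ := he
      _ ≤ ‖s‖ ^ 3 := by
        rw [← norm_mul]
        have : ‖c * s‖ ^ 3 ≤ ‖s‖ ^ 3 := by gcongr
        linarith [norm_nonneg (c * s), pow_nonneg (norm_nonneg (c * s)) 3]
  have key : QQ c w = e * (s ^ 2)⁻¹ + Complex.exp (c * s) * h := by
    rw [QQ, FF, hinv, Complex.cpow_neg_one, ← hs]
    have : (Real.pi : ℂ) / Complex.sin (Real.pi * w) = h + (s ^ 2)⁻¹ := by
      rw [hh, hs2]; ring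
    rw [this, ← hs2, hee]
    field_simp; ring
  rw [key]
  refine (norm_add_le _ _).trans ?_
  rw [norm_mul, norm_mul, norm_inv, norm_pow]
  have h1 : ‖e‖ * (‖s‖ ^ 2)⁻¹ ≤ ‖s‖ := by
    calc ‖e‖ * (‖s‖ ^ 2)⁻¹ ≤ ‖s‖ ^ 3 * (‖s‖ ^ 2)⁻¹ := by gcongr
      _ = ‖s‖ := by field_simp
  have h2 : ‖Complex.exp (c * s)‖ ≤ 3 := by
    refine (Complex.norm_exp_le_exp_norm _).trans ?_
    have := Real.exp_le_exp.mpr (hcs.trans (by linarith : ‖s‖ ≤ 1))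
    linarith [Real.exp_one_lt_d9]
  have h3 : ‖h‖ ≤ 4 * ‖s‖ := by
    rw [hwn] at hcsc; nlinarith
  calc _ ≤ ‖s‖ + 3 * (4 * ‖s‖) := by gcongr
    _ ≤ _ := by linarith

def UU : Set ℂ := {w | w ∈ Complex.slitPlane ∧ |w.re| < 1}

lemma isOpen_UU : IsOpen UU :=
  Complex.isOpen_slitPlane.inter (isOpen_lt (Complex.continuous_re.abs) continuous_const)

lemma sin_ne {w : ℂ} (hw : w ∈ UU) : Complex.sin (Real.pi * w) ≠ 0 := by
  rw [Ne, Complex.sin_eq_zero_iff]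
  rintro ⟨k, hk⟩
  have hpi : (Real.pi : ℂ) ≠ 0 := by exact_mod_cast Real.pi_ne_zero
  have hwk : w = k := by
    apply mul_left_cancel₀ hpi; rw [hk]; ring
  obtain ⟨h1, h2⟩ := hw
  rw [hwk] at h1 h2
  simp only [Complex.intCast_re] at h2
  have h2' : |k| < 1 := by exact_mod_cast h2
  rw [Int.abs_lt_one_iff] at h2'
  subst h2'
  simp at h1

lemma FF_diff (c : ℂ) {w : ℂ} (hw : w ∈ UU) : DifferentiableAt ℂ (FF c) w := by
  unfold FF
  have := sin_ne hw
  have h1 := hw.1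
  have : DifferentiableAt ℂ (fun w : ℂ => w ^ (1 / 2 : ℂ)) w :=
    (differentiableAt_id).cpow_const h1
  fun_prop (disch := assumption)

lemma FF_diffOn (c : ℂ) : DifferentiableOn ℂ (FF c) UU := fun _ hw =>
  (FF_diff c hw).differentiableWithinAt

lemma mem_UU {w : ℂ} (h0 : 0 < w.re) (h1 : w.re < 1) : w ∈ UU :=
  ⟨Or.inl h0, by rw [abs_of_pos h0]; exact h1⟩

lemma int_rpow_exp {s r : ℝ} (hs : 0 < s) (hr : 0 < r) :
    IntegrableOn (fun x : ℝ => x ^ (s - 1) * Real.exp (-r * x)) (Set.Ioi 0) := by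
  have := integrableOn_rpow_mul_exp_neg_mul_rpow (p := 1) (s := s - 1) (b := r)
    (by linarith) one_pos hr
  simpa using this

noncomputable def gmeas (s : ℝ) : Measure ℝ :=
  (volume.restrict (Set.Ioi 0)).withDensity (fun x => ((Real.toNNReal (x ^ (s - 1)) : NNReal) : ENNReal))

lemma gdens_meas (s : ℝ) : Measurable (fun x : ℝ => Real.toNNReal (x ^ (s - 1))) := by
  fun_prop

lemma gmeas_int {s r : ℝ} (hs : 0 < s) (hr : 0 < r) :
    -r ∈ ProbabilityTheory.integrableExpSet id (gmeas s) := by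
  rw [ProbabilityTheory.integrableExpSet, Set.mem_ofPred_eq, gmeas,
    integrable_withDensity_iff_integrable_smul (gdens_meas s)]
  refine (int_rpow_exp hs hr).congr ?_
  filter_upwards [ae_restrict_mem measurableSet_Ioi] with x hx
  have hx : 0 < x := hx
  simp only [NNReal.smul_def, smul_eq_mul, id]
  rw [Real.coe_toNNReal _ (by positivity)]

lemma laplace_rpow {s : ℝ} (hs : 0 < s) {w : ℂ} (hw : 0 < w.re) :
    ∫ x in Set.Ioi (0 : ℝ), ((x ^ (s - 1) : ℝ) : ℂ) * Complex.exp (-(w * x)) =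
      w ^ (-(s : ℂ)) * (Real.Gamma s : ℂ) := by
  have hM : ∀ w : ℂ, ∫ x in Set.Ioi (0 : ℝ), ((x ^ (s - 1) : ℝ) : ℂ) * Complex.exp (-(w * x))
      = ProbabilityTheory.complexMGF id (gmeas s) (-w) := by
    intro w
    rw [ProbabilityTheory.complexMGF, gmeas, integral_withDensity_eq_integral_smul (gdens_meas s)]
    refine setIntegral_congr_fun measurableSet_Ioi ?_
    intro x hx
    have hx : 0 < x := hx
    simp only [NNReal.smul_def, Complex.real_smul, id]
    rw [Real.coe_toNNReal _ (by positivity)]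
    simp
  let U : Set ℂ := {w | 0 < w.re}
  have hUo : IsOpen U := isOpen_lt continuous_const Complex.continuous_re
  have h1 : AnalyticOnNhd ℂ (fun w : ℂ => ProbabilityTheory.complexMGF id (gmeas s) (-w)) U := by
    apply DifferentiableOn.analyticOnNhd _ hUo
    intro w hw
    have hw : 0 < w.re := hw
    apply DifferentiableAt.differentiableWithinAt
    have : (-w).re ∈ interior (ProbabilityTheory.integrableExpSet id (gmeas s)) := by
      have : Set.Iio 0 ⊆ ProbabilityTheory.integrableExpSet id (gmeas s) := by
        intro y hy
        have := gmeas_int hs (r := -y) (by simpa using hy)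
        simpa using this
      apply interior_maximal this isOpen_Iio
      simpa using hw
    exact (ProbabilityTheory.hasDerivAt_complexMGF this).differentiableAt.comp w
      (differentiableAt_id.neg)
  have h2 : AnalyticOnNhd ℂ (fun w : ℂ => w ^ (-(s : ℂ)) * (Real.Gamma s : ℂ)) U := by
    apply DifferentiableOn.analyticOnNhd _ hUo
    intro w hw
    apply DifferentiableAt.differentiableWithinAt
    exact (differentiableAt_id.cpow_const (Or.inl hw)).mul_const _
  have hU : IsPreconnected U := (convex_halfSpace_re_gt 0).isPreconnected
  rw [hM]
  refine h1.eqOn_of_preconnected_of_frequently_eq h2 hU (z₀ := 1) (by simp [U]) ?_ hw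
  have hreal : ∀ r : ℝ, 0 < r → ProbabilityTheory.complexMGF id (gmeas s) (-(r : ℂ)) =
      (r : ℂ) ^ (-(s : ℂ)) * (Real.Gamma s : ℂ) := by
    intro r hr
    rw [← hM]
    have := Real.integral_rpow_mul_exp_neg_mul_Ioi hs hr
    have e1 : (1 / r) ^ s = r ^ (-s) := by
      rw [one_div, Real.inv_rpow hr.le, Real.rpow_neg hr.le]
    rw [e1] at this
    have e2 : (r : ℂ) ^ (-(s : ℂ)) = ((r ^ (-s) : ℝ) : ℂ) := by
      rw [Complex.ofReal_cpow hr.le]; simp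
    rw [e2, ← Complex.ofReal_mul, ← this, ← integral_complex_ofReal]
    refine integral_congr_ae (Eventually.of_forall fun x => ?_)
    simp
  have hf : ∃ᶠ r : ℝ in nhdsWithin 1 {1}ᶜ, ProbabilityTheory.complexMGF id (gmeas s) (-(r : ℂ)) =
      (r : ℂ) ^ (-(s : ℂ)) * (Real.Gamma s : ℂ) := by
    apply Eventually.frequently
    filter_upwards [nhdsWithin_le_nhds (Ioi_mem_nhds (zero_lt_one' ℝ))] with r hr using hreal r hr
  have ht : Tendsto (fun r : ℝ => (r : ℂ)) (nhdsWithin 1 {1}ᶜ) (nhdsWithin 1 {1}ᶜ) := by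
    apply tendsto_nhdsWithin_of_tendsto_nhds_of_eventually_within
    · exact (Complex.continuous_ofReal.tendsto' 1 1 (by simp)).mono_left nhdsWithin_le_nhds
    · filter_upwards [self_mem_nhdsWithin] with r hr
      simpa using hr
  exact ht.frequently hf

lemma line_pow_integrable {a s : ℝ} (ha : 0 < a) (hs : 1 < s) :
    Integrable (fun t : ℝ => ‖(a + t * Complex.I : ℂ)‖ ^ (-s)) := by
  have h := (integrable_rpow_neg_one_add_norm_sq (E := ℝ) (μ := volume) (r := s) (by simpa using hs))
  have h2 := (h.comp_mul_left' (R := a⁻¹) (by positivity)).const_mul (a ^ (-s))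
  refine h2.congr (Eventually.of_forall fun t => ?_)
  have h0 : ‖(a + t * Complex.I : ℂ)‖ = a * (1 + ‖a⁻¹ * t‖ ^ 2) ^ (1 / 2 : ℝ) := by
    rw [Complex.norm_add_mul_I, ← Real.sqrt_eq_rpow]
    have : a ^ 2 + t ^ 2 = a ^ 2 * (1 + ‖a⁻¹ * t‖ ^ 2) := by
      rw [Real.norm_eq_abs, sq_abs]; field_simp
    rw [this, Real.sqrt_mul (by positivity), Real.sqrt_sq ha.le]
  simp only
  rw [h0, Real.mul_rpow ha.le (by positivity), ← Real.rpow_mul (by positivity)]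
  ring_nf

lemma line_pow_integral {a s : ℝ} (ha : 0 < a) :
    ∫ t : ℝ, ‖(a + t * Complex.I : ℂ)‖ ^ (-s) =
      a ^ (1 - s) * ∫ t : ℝ, ‖(1 + t * Complex.I : ℂ)‖ ^ (-s) := by
  have h := Measure.integral_comp_mul_left
    (fun t : ℝ => ‖(1 + t * Complex.I : ℂ)‖ ^ (-s)) a⁻¹
  have h1 : ∀ t : ℝ, ‖(a + t * Complex.I : ℂ)‖ ^ (-s) =
      a ^ (-s) * ‖(1 + (a⁻¹ * t : ℝ) * Complex.I : ℂ)‖ ^ (-s) := by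
    intro t
    rw [← Real.mul_rpow ha.le (norm_nonneg _)]
    congr 1
    have : (a : ℂ) ≠ 0 := by exact_mod_cast ha.ne'
    have e : (a + t * Complex.I : ℂ) = a * (1 + (a⁻¹ * t : ℝ) * Complex.I) := by
      push_cast
      field_simp
    rw [e, norm_mul, Complex.norm_real, Real.norm_of_nonneg ha.le]
  simp_rw [h1]
  rw [integral_const_mul, h, inv_inv, abs_of_pos ha, smul_eq_mul, ← mul_assoc]
  congr 1
  rw [show 1 - s = -s + 1 by ring, Real.rpow_add ha, Real.rpow_one]

lemma cpow_line_continuous {a : ℝ} (ha : 0 < a) (s : ℂ) :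
    Continuous (fun t : ℝ => (a + t * Complex.I : ℂ) ^ s) := by
  refine Continuous.cpow (by fun_prop) continuous_const ?_
  intro t
  left; simpa using ha

lemma norm_line_cpow {a : ℝ} (s t : ℝ) :
    ‖(a + t * Complex.I : ℂ) ^ (-(s : ℂ))‖ = ‖(a + t * Complex.I : ℂ)‖ ^ (-s) := by
  have := Complex.norm_cpow_real (a + t * Complex.I : ℂ) (-s)
  rw [← this]; simp

lemma inv_laplace {s a L : ℝ} (hs : 1 < s) (ha : 0 < a) (hL : 0 < L) :
    ∫ t : ℝ, (a + t * Complex.I : ℂ) ^ (-(s : ℂ)) * Complex.exp ((a + t * Complex.I) * L) =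
      2 * Real.pi * (L ^ (s - 1) : ℝ) / (Real.Gamma s : ℝ) := by
  have hs0 : 0 < s := by linarith
  have hG : (Real.Gamma s : ℂ) ≠ 0 := by exact_mod_cast (Real.Gamma_pos_of_pos hs0).ne'
  have hpi : (Real.pi : ℂ) ≠ 0 := by exact_mod_cast Real.pi_ne_zero
  let f : ℝ → ℂ := Set.indicator (Set.Ioi 0)
    (fun x => ((x ^ (s - 1) : ℝ) : ℂ) * Complex.exp (-(a * x)))
  have hfi : Integrable f := by
    rw [integrable_indicator_iff measurableSet_Ioi]
    have := (int_rpow_exp hs0 ha).ofReal (𝕜 := ℂ)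
    refine Integrable.congr this (Eventually.of_forall fun x => ?_)
    simp
  have hF : ∀ ξ : ℝ, FourierTransform.fourier f ξ =
      (a + (2 * Real.pi * ξ : ℝ) * Complex.I : ℂ) ^ (-(s : ℂ)) * (Real.Gamma s : ℂ) := by
    intro ξ
    rw [Real.fourier_real_eq_integral_exp_smul, ← laplace_rpow hs0 (by simpa using ha),
      ← integral_indicator measurableSet_Ioi]
    refine integral_congr_ae (Eventually.of_forall fun x => ?_)
    simp only [f, Set.indicator]
    split_ifs with h
    · rw [smul_eq_mul, mul_left_comm, ← Complex.exp_add]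
      congr 2
      push_cast; ring
    · simp
  have hg : Integrable (fun t : ℝ => (a + t * Complex.I : ℂ) ^ (-(s : ℂ)) * (Real.Gamma s : ℂ)) := by
    apply Integrable.mul_const
    refine (line_pow_integrable ha hs).mono' (cpow_line_continuous ha _).aestronglyMeasurable
      (Eventually.of_forall fun t => ?_)
    rw [norm_line_cpow]
  have hFi : Integrable (FourierTransform.fourier f) := by
    have := hg.comp_mul_left' (R := 2 * Real.pi) (by positivity)
    refine this.congr (Eventually.of_forall fun ξ => ?_)
    simp only [hF]
  have hc : ContinuousAt f L := by
    have : f =ᶠ[nhds L] (fun x => ((x ^ (s - 1) : ℝ) : ℂ) * Complex.exp (-(a * x))) := by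
      filter_upwards [Ioi_mem_nhds hL] with x hx
      exact Set.indicator_of_mem hx _
    refine ContinuousAt.congr ?_ this.symm
    have : ContinuousAt (fun x : ℝ => x ^ (s - 1)) L := Real.continuousAt_rpow_const _ _ (Or.inl hL.ne')
    fun_prop
  have key := hfi.fourierInv_fourier_eq hFi hc
  rw [Real.fourierInv_eq'] at key
  have hfL : f L = ((L ^ (s - 1) : ℝ) : ℂ) * Complex.exp (-(a * L)) :=
    Set.indicator_of_mem (show L ∈ Set.Ioi (0:ℝ) from hL) _
  rw [hfL] at key
  have hsub := Measure.integral_comp_mul_left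
    (fun t : ℝ => (a + t * Complex.I : ℂ) ^ (-(s : ℂ)) * Complex.exp ((a + t * Complex.I) * L)) (2 * Real.pi)
  have hk2 : ∫ x : ℝ, (a + (2 * Real.pi * x : ℝ) * Complex.I : ℂ) ^ (-(s : ℂ)) *
      Complex.exp ((a + (2 * Real.pi * x : ℝ) * Complex.I) * L) =
      (Complex.exp (a * L) / Real.Gamma s) * (((L ^ (s - 1) : ℝ) : ℂ) * Complex.exp (-(a * L))) := by
    rw [← key, ← integral_const_mul]
    refine integral_congr_ae (Eventually.of_forall fun x => ?_)
    simp only [hF, smul_eq_mul]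
    have : Complex.exp ((a + (2 * Real.pi * x : ℝ) * Complex.I) * L) =
      Complex.exp (a * L) * Complex.exp ((2 * Real.pi * inner ℝ x L : ℝ) * Complex.I) := by
      rw [← Complex.exp_add]
      congr 1
      simp
      ring
    rw [this]
    field_simp
  rw [hk2] at hsub
  have hp : |(2 * Real.pi)⁻¹| = (2 * Real.pi)⁻¹ := abs_of_pos (by positivity)
  rw [hp, Complex.real_smul] at hsub
  have he : Complex.exp (a * L) * Complex.exp (-(a * L)) = 1 := by
    rw [← Complex.exp_add]; simp
  push_cast at hsub ⊢
  rw [eq_comm, inv_mul_eq_iff_eq_mul₀ (by simp)] at hsub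
  rw [hsub]
  calc _ = 2 * (Real.pi : ℂ) * ((L ^ (s - 1) : ℝ) : ℂ) / Real.Gamma s *
      (Complex.exp (a * L) * Complex.exp (-(a * L))) := by ring
    _ = _ := by rw [he]; ring

lemma FF_analytic (c : ℂ) : AnalyticOnNhd ℂ (FF c) UU :=
  (FF_diffOn c).analyticOnNhd isOpen_UU

lemma FF_iter_diff (c : ℂ) (n : ℕ) {w : ℂ} (hw : w ∈ UU) :
    DifferentiableAt ℂ (iteratedDeriv n (FF c)) w := by
  have h := ((FF_analytic c).iterated_deriv n) w hw
  rw [← iteratedDeriv_eq_iterate] at h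
  exact h.differentiableAt

noncomputable def KK : ℝ := 80 * Real.pi * Real.exp 2

lemma KK_pos : 0 < KK := by unfold KK; positivity

lemma FF_iter_far {c w : ℂ} (n : ℕ) (hc : ‖c‖ ≤ 1) (hre : |w.re| ≤ 1 / 2) (him : 1 / 10 ≤ |w.im|) :
    ‖iteratedDeriv n (FF c) w‖ ≤ n.factorial * (KK / (1 + w.im ^ 2)) / (1 / 20) ^ n := by
  have hb : ∀ z ∈ Metric.closedBall w (1 / 20), |z.re| < 1 ∧ |w.im| / 2 ≤ |z.im| := by
    intro z hz
    rw [Metric.mem_closedBall, dist_eq_norm] at hz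
    have h1 := (Complex.abs_re_le_norm (z - w)).trans hz
    have h2 := (Complex.abs_im_le_norm (z - w)).trans hz
    rw [Complex.sub_re] at h1
    rw [Complex.sub_im] at h2
    constructor
    · have := abs_sub_abs_le_abs_sub z.re w.re
      linarith
    · have := abs_sub_abs_le_abs_sub w.im z.im
      rw [abs_sub_comm] at this
      linarith
  apply Complex.norm_iteratedDeriv_le_of_forall_mem_sphere_norm_le n (by norm_num)
  · apply DifferentiableOn.diffContOnCl_ball (FF_diffOn c)
    intro z hz
    obtain ⟨h1, h2⟩ := hb z hz
    refine ⟨Or.inr ?_, h1⟩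
    intro h0
    rw [h0, abs_zero] at h2
    linarith
  · intro z hz
    obtain ⟨h1, h2⟩ := hb z (Metric.sphere_subset_closedBall hz)
    refine (FF_far hc h1.le (by linarith)).trans ?_
    rw [div_le_div_iff₀ (by positivity) (by positivity), KK]
    have h3 : w.im ^ 2 ≤ 4 * z.im ^ 2 := by
      rw [← sq_abs w.im, ← sq_abs z.im]
      nlinarith [abs_nonneg w.im]
    have h4 : 0 < Real.pi * Real.exp 2 := by positivity
    nlinarith

lemma line_mem {a : ℝ} (ha : 0 < a) (ha1 : a < 1) (t : ℝ) : (a + t * Complex.I : ℂ) ∈ UU :=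
  mem_UU (by simpa using ha) (by simpa using ha1)

lemma line_hasDeriv (a t : ℝ) : HasDerivAt (fun t : ℝ => (a + t * Complex.I : ℂ)) Complex.I t := by
  have := ((Complex.ofRealCLM.hasDerivAt (x := t)).mul_const Complex.I).const_add (a : ℂ)
  simpa using this

lemma FF_line_hasDeriv (c : ℂ) (n : ℕ) {a : ℝ} (ha : 0 < a) (ha1 : a < 1) (t : ℝ) :
    HasDerivAt (fun t : ℝ => iteratedDeriv n (FF c) (a + t * Complex.I))
      (iteratedDeriv (n + 1) (FF c) (a + t * Complex.I) * Complex.I) t := by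
  have h1 := (FF_iter_diff c n (line_mem ha ha1 t)).hasDerivAt
  rw [← iteratedDeriv_succ] at h1
  exact h1.comp t (line_hasDeriv a t)

lemma FF_line_integrable {c : ℂ} (n : ℕ) (hc : ‖c‖ ≤ 1) {a : ℝ} (ha : 0 < a) (ha1 : a ≤ 1 / 2) :
    Integrable (fun t : ℝ => iteratedDeriv n (FF c) (a + t * Complex.I)) := by
  have hcont : Continuous (fun t : ℝ => iteratedDeriv n (FF c) (a + t * Complex.I)) :=
    continuous_iff_continuousAt.mpr fun t => (FF_line_hasDeriv c n ha (by linarith) t).continuousAt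
  have hb : ∀ t : ℝ, 1 / 10 ≤ |t| → ‖iteratedDeriv n (FF c) (a + t * Complex.I)‖ ≤
      (n.factorial * KK / (1 / 20) ^ n) * ‖(1 + t ^ 2)⁻¹‖ := by
    intro t ht
    have := FF_iter_far (w := a + t * Complex.I) n hc (by simpa [abs_of_pos ha] using ha1)
      (by simpa using ht)
    refine this.trans (le_of_eq ?_)
    rw [Real.norm_of_nonneg (by positivity)]
    simp
    ring
  refine hcont.locallyIntegrable.integrable_of_isBigO_atBot_atTop (g := fun t : ℝ => (1 + t ^ 2)⁻¹)
    (g' := fun t : ℝ => (1 + t ^ 2)⁻¹) ?_ (integrable_inv_one_add_sq.integrableAtFilter _) ?_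
    (integrable_inv_one_add_sq.integrableAtFilter _)
  · apply IsBigO.of_bound (n.factorial * KK / (1 / 20) ^ n)
    filter_upwards [eventually_le_atBot (-1)] with t ht
    exact hb t (by rw [abs_of_nonpos (by linarith)]; linarith)
  · apply IsBigO.of_bound (n.factorial * KK / (1 / 20) ^ n)
    filter_upwards [eventually_ge_atTop 1] with t ht
    exact hb t (by rw [abs_of_nonneg (by linarith)]; linarith)

lemma norm_exp_line (a L t : ℝ) : ‖Complex.exp ((a + t * Complex.I) * L)‖ = Real.exp (a * L) := by
  rw [Complex.norm_exp]; simp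

lemma mul_exp_integrable {g : ℝ → ℂ} (hg : Integrable g) (a L : ℝ) :
    Integrable (fun t : ℝ => g t * Complex.exp ((a + t * Complex.I) * L)) := by
  refine hg.mul_bdd (c := Real.exp (a * L)) ?_ ?_
  · apply Continuous.aestronglyMeasurable; fun_prop
  · exact Eventually.of_forall fun t => (norm_exp_line a L t).le

lemma ibp {c : ℂ} (n : ℕ) (hc : ‖c‖ ≤ 1) {a L : ℝ} (ha : 0 < a) (ha1 : a ≤ 1 / 2) :
    L * ∫ t : ℝ, iteratedDeriv n (FF c) (a + t * Complex.I) * Complex.exp ((a + t * Complex.I) * L)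
    = - ∫ t : ℝ, iteratedDeriv (n + 1) (FF c) (a + t * Complex.I) *
        Complex.exp ((a + t * Complex.I) * L) := by
  have i0 := mul_exp_integrable (FF_line_integrable n hc ha ha1) a L
  have i1 := mul_exp_integrable (FF_line_integrable (n + 1) hc ha ha1) a L
  have key := integral_mul_deriv_eq_deriv_mul_of_integrable
    (u := fun t : ℝ => iteratedDeriv n (FF c) (a + t * Complex.I))
    (v := fun t : ℝ => Complex.exp ((a + t * Complex.I) * L))
    (u' := fun t : ℝ => iteratedDeriv (n + 1) (FF c) (a + t * Complex.I) * Complex.I)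
    (v' := fun t : ℝ => Complex.exp ((a + t * Complex.I) * L) * (Complex.I * L))
    (fun t _ => FF_line_hasDeriv c n ha (by linarith) t)
    (fun t _ => ((line_hasDeriv a t).mul_const (L : ℂ)).cexp)
    (by
      refine (i0.mul_const (Complex.I * L)).congr (Eventually.of_forall fun t => ?_)
      simp only [Pi.mul_apply]; ring)
    (by
      refine (i1.mul_const Complex.I).congr (Eventually.of_forall fun t => ?_)
      simp only [Pi.mul_apply]; ring)
    i0
  have e1 : ∀ t : ℝ, iteratedDeriv n (FF c) (a + t * Complex.I) *
      (Complex.exp ((a + t * Complex.I) * L) * (Complex.I * L)) =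
      (Complex.I * L) * (iteratedDeriv n (FF c) (a + t * Complex.I) *
      Complex.exp ((a + t * Complex.I) * L)) := fun t => by ring
  have e2 : ∀ t : ℝ, iteratedDeriv (n + 1) (FF c) (a + t * Complex.I) * Complex.I *
      Complex.exp ((a + t * Complex.I) * L) =
      Complex.I * (iteratedDeriv (n + 1) (FF c) (a + t * Complex.I) *
      Complex.exp ((a + t * Complex.I) * L)) := fun t => by ring
  simp_rw [e1, e2] at key
  rw [integral_const_mul, integral_const_mul, mul_assoc, ← mul_neg] at key
  exact mul_left_cancel₀ Complex.I_ne_zero key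

lemma shift {c : ℂ} (hc : ‖c‖ ≤ 1) {a L : ℝ} (ha : 0 < a) (ha1 : a ≤ 1 / 2) (hL : 0 < L) :
    ∫ t : ℝ, FF c (1 / 2 + t * Complex.I) * Complex.exp ((1 / 2 + t * Complex.I) * L) =
    ∫ t : ℝ, FF c (a + t * Complex.I) * Complex.exp ((a + t * Complex.I) * L) := by
  let h : ℂ → ℂ := fun w => FF c w * Complex.exp (w * L)
  have i0 : Integrable (fun t : ℝ => h (a + t * Complex.I)) := by
    have := mul_exp_integrable (FF_line_integrable 0 hc ha ha1) a L
    simpa only [iteratedDeriv_zero] using this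
  have i1 : Integrable (fun t : ℝ => h ((1 / 2 : ℝ) + t * Complex.I)) := by
    have := mul_exp_integrable (FF_line_integrable (a := 1 / 2) 0 hc (by norm_num) le_rfl) (1 / 2) L
    simpa only [iteratedDeriv_zero] using this
  have t0 := intervalIntegral_tendsto_integral i0 (tendsto_neg_atTop_atBot) (tendsto_id (x := atTop))
  have t1 := intervalIntegral_tendsto_integral i1 (tendsto_neg_atTop_atBot) (tendsto_id (x := atTop))
  have hrect : ∀ T : ℝ, (∫ x : ℝ in a..(1 / 2), h (x + (-T : ℝ) * Complex.I)) -
      (∫ x : ℝ in a..(1 / 2), h (x + T * Complex.I)) +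
      Complex.I • (∫ y : ℝ in (-T)..T, h ((1 / 2 : ℝ) + y * Complex.I)) -
      Complex.I • (∫ y : ℝ in (-T)..T, h (a + y * Complex.I)) = 0 := by
    intro T
    have := Complex.integral_boundary_rect_eq_zero_of_differentiableOn h
      (⟨a, -T⟩ : ℂ) (⟨1 / 2, T⟩ : ℂ) ?_
    · exact this
    · intro w hw
      rw [Complex.mem_reProdIm] at hw
      have hw1 := hw.1
      simp only [Set.uIcc_of_le ha1, Set.mem_Icc] at hw1
      have := FF_diff c (mem_UU (w := w) (by linarith) (by linarith))
      apply DifferentiableAt.differentiableWithinAt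
      simp only [h]
      fun_prop
  have hhor : Tendsto (fun T : ℝ => (20 * Real.pi * Real.exp 2) / (1 + T ^ 2) * Real.exp L * |1 / 2 - a|)
      atTop (nhds 0) := by
    have : Tendsto (fun T : ℝ => 1 + T ^ 2) atTop atTop :=
      tendsto_atTop_add_const_left _ _ (tendsto_pow_atTop (by norm_num))
    have h2 := (((tendsto_const_nhds (x := 20 * Real.pi * Real.exp 2)).div_atTop this).mul_const
      (Real.exp L)).mul_const |1 / 2 - a|
    simpa using h2
  have hbd : ∀ T : ℝ, 1 ≤ |T| → ‖∫ x : ℝ in a..(1 / 2), h (x + T * Complex.I)‖ ≤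
      (20 * Real.pi * Real.exp 2) / (1 + T ^ 2) * Real.exp L * |1 / 2 - a| := by
    intro T hT
    apply intervalIntegral.norm_integral_le_of_norm_le_const
    intro x hx
    rw [Set.uIoc_of_le ha1] at hx
    have hx0 : 0 < x := ha.trans hx.1
    have hx1 := hx.2
    simp only [h]
    rw [norm_mul, norm_exp_line]
    have := FF_far (w := x + T * Complex.I) hc (by simp [abs_of_pos hx0]; linarith)
      (by simp; linarith)
    simp only [Complex.add_im, Complex.ofReal_im, Complex.mul_im, Complex.ofReal_re, Complex.I_im,
      Complex.I_re, mul_one, mul_zero, add_zero, zero_add] at this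
    gcongr
    nlinarith
  have l1 : Tendsto (fun T : ℝ => ∫ x : ℝ in a..(1 / 2), h (x + T * Complex.I)) atTop (nhds 0) := by
    apply squeeze_zero_norm' _ hhor
    filter_upwards [eventually_ge_atTop 1] with T hT
    exact hbd T (by rw [abs_of_nonneg] <;> linarith)
  have l2 : Tendsto (fun T : ℝ => ∫ x : ℝ in a..(1 / 2), h (x + (-T : ℝ) * Complex.I)) atTop (nhds 0) := by
    apply squeeze_zero_norm' _ hhor
    filter_upwards [eventually_ge_atTop 1] with T hT
    have := hbd (-T) (by rw [abs_neg, abs_of_nonneg] <;> linarith)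
    rwa [neg_sq] at this
  have lim := ((l2.sub l1).add (t1.const_smul Complex.I)).sub (t0.const_smul Complex.I)
  have lim0 := tendsto_nhds_unique (lim.congr (fun T => hrect T)) tendsto_const_nhds
  rw [sub_self, zero_add, ← smul_sub, smul_eq_zero] at lim0
  have := sub_eq_zero.mp (lim0.resolve_left Complex.I_ne_zero)
  simp only [h] at this
  push_cast at this
  exact this

lemma cpow_hasDeriv {w : ℂ} (hw : w ∈ Complex.slitPlane) (p q : ℂ) (hq : q = p - 1) :
    HasDerivAt (fun w : ℂ => w ^ p) (p * w ^ q) w := by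
  have := (hasDerivAt_id w).cpow_const (c := p) hw
  subst hq
  simpa using this

lemma QQ_hasDeriv (c : ℂ) {w : ℂ} (hw : w ∈ UU) :
    HasDerivAt (QQ c) (deriv (FF c) w + w ^ (-2 : ℂ) + c / 2 * w ^ (-(3 / 2) : ℂ)) w := by
  have h1 := (FF_diff c hw).hasDerivAt
  have h2 := cpow_hasDeriv hw.1 (-1) (-2) (by norm_num)
  have h3 := (cpow_hasDeriv hw.1 (-(1 / 2)) (-(3 / 2)) (by norm_num)).const_mul c
  have := ((h1.sub h2).sub h3).sub_const (c ^ 2 / 2)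
  convert! this using 1
  ring

lemma QQ_deriv2 (c : ℂ) {w : ℂ} (hw : w ∈ UU) :
    iteratedDeriv 2 (QQ c) w = iteratedDeriv 2 (FF c) w - 2 * w ^ (-((3 : ℝ) : ℂ)) -
      c * (3 / 4) * w ^ (-((5 / 2 : ℝ) : ℂ)) := by
  have e3 : (-((3 : ℝ) : ℂ)) = -3 := by norm_num
  have e5 : (-((5 / 2 : ℝ) : ℂ)) = -(5 / 2) := by norm_num
  rw [e3, e5]
  have ev : deriv (QQ c) =ᶠ[nhds w]
      fun w => deriv (FF c) w + w ^ (-2 : ℂ) + c / 2 * w ^ (-(3 / 2) : ℂ) := by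
    filter_upwards [isOpen_UU.mem_nhds hw] with v hv
    exact (QQ_hasDeriv c hv).deriv
  rw [iteratedDeriv_succ, iteratedDeriv_one, ev.deriv_eq]
  have h1 := (FF_iter_diff c 1 hw).hasDerivAt
  rw [← iteratedDeriv_succ, iteratedDeriv_one] at h1
  have h2 := cpow_hasDeriv hw.1 (-2) (-3) (by norm_num)
  have h3 := (cpow_hasDeriv hw.1 (-(3 / 2)) (-(5 / 2)) (by norm_num)).const_mul (c / 2)
  have := ((h1.add h2).add h3).deriv
  refine Eq.trans this ?_
  ring

lemma QQ_near2 {c w : ℂ} (hc : ‖c‖ ≤ 1) (h0 : 0 < w.re) (hw : ‖w‖ ≤ 1 / 6) :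
    ‖iteratedDeriv 2 (QQ c) w‖ ≤ 1600 * ‖w‖ ^ (-(3 / 2) : ℝ) := by
  have hwp : 0 < ‖w‖ := norm_pos_iff.mpr (by rintro rfl; simp at h0)
  have hb : ∀ z ∈ Metric.closedBall w (‖w‖ / 2), z ∈ UU ∧ ‖z‖ ≤ 1 / 4 ∧ ‖z‖ ≤ 4 * ‖w‖ := by
    intro z hz
    rw [Metric.mem_closedBall, dist_eq_norm] at hz
    have hz1 := norm_sub_norm_le z w
    refine ⟨⟨?_, ?_⟩, by linarith, by linarith⟩
    · by_contra hcon
      rw [Complex.mem_slitPlane_iff, not_or, not_lt, not_not] at hcon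
      obtain ⟨h1, h2⟩ := hcon
      have h3 : ‖w‖ ^ 2 ≤ ‖z - w‖ ^ 2 := by
        rw [Complex.sq_norm, Complex.sq_norm, Complex.normSq_apply, Complex.normSq_apply,
          Complex.sub_re, Complex.sub_im, h2]
        nlinarith
      nlinarith [norm_nonneg (z - w)]
    · have := Complex.abs_re_le_norm z
      linarith
  have key := Complex.norm_iteratedDeriv_le_of_forall_mem_sphere_norm_le (f := QQ c) (c := w)
    (R := ‖w‖ / 2) (C := 200 * ‖w‖ ^ (1 / 2 : ℝ)) 2 (by positivity) ?_ ?_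
  · refine key.trans (le_of_eq ?_)
    have e : ‖w‖ ^ (1 / 2 : ℝ) = ‖w‖ ^ (-(3 / 2) : ℝ) * ‖w‖ ^ 2 := by
      rw [← Real.rpow_natCast ‖w‖ 2, ← Real.rpow_add hwp]; norm_num
    rw [e]
    norm_num [Nat.factorial]
    field_simp
    ring
  · apply DifferentiableOn.diffContOnCl_ball (U := UU)
    · exact fun z hz => (QQ_hasDeriv c hz).differentiableAt.differentiableWithinAt
    · exact fun z hz => (hb z hz).1
  · intro z hz
    obtain ⟨h1, h2, h3⟩ := hb z (Metric.sphere_subset_closedBall hz)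
    refine (QQ_near hc (Complex.slitPlane_ne_zero h1.1) h2).trans ?_
    have : ‖z‖ ^ (1 / 2 : ℝ) ≤ 2 * ‖w‖ ^ (1 / 2 : ℝ) := by
      calc ‖z‖ ^ (1 / 2 : ℝ) ≤ (4 * ‖w‖) ^ (1 / 2 : ℝ) := by gcongr
        _ = 2 * ‖w‖ ^ (1 / 2 : ℝ) := by
          rw [Real.mul_rpow (by norm_num) hwp.le]
          congr 1
          rw [show (4 : ℝ) = 2 ^ (2 : ℝ) by norm_num, ← Real.rpow_mul (by norm_num)]
          norm_num
    linarith

lemma rpow_aux {x p : ℝ} (hx : 1 / 6 ≤ x) (hp : 3 / 2 ≤ p) (hp2 : p ≤ 7 / 2) :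
    x ^ (-p) ≤ 36 * x ^ (-(3 / 2) : ℝ) := by
  have hx0 : 0 < x := by linarith
  have h1 : x ^ (-(p - 3 / 2)) ≤ 36 := by
    calc x ^ (-(p - 3 / 2)) ≤ (1 / 6) ^ (-(p - 3 / 2)) :=
          Real.rpow_le_rpow_of_nonpos (by norm_num) hx (by linarith)
      _ = 6 ^ (p - 3 / 2) := by
          rw [one_div, Real.inv_rpow (by norm_num), Real.rpow_neg (by norm_num), inv_inv]
      _ ≤ 6 ^ (2 : ℝ) := Real.rpow_le_rpow_of_exponent_le (by norm_num) (by linarith)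
      _ = 36 := by norm_num
  rw [show -p = -(p - 3 / 2) + -(3 / 2) by ring, Real.rpow_add hx0]
  gcongr

noncomputable def K2 : ℝ := 1600 + 800 * KK * 36 + 200

lemma model_bound {c w : ℂ} (hc : ‖c‖ ≤ 1) (h0 : 0 < w.re) (h1 : w.re ≤ 1 / 20) :
    ‖iteratedDeriv 2 (FF c) w - 2 * w ^ (-((3 : ℝ) : ℂ)) -
      c * (3 / 4) * w ^ (-((5 / 2 : ℝ) : ℂ))‖ ≤ K2 * ‖w‖ ^ (-(3 / 2) : ℝ) := by
  have hwp : 0 < ‖w‖ := norm_pos_iff.mpr (by rintro rfl; simp at h0)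
  have hK := KK_pos
  rcases le_total ‖w‖ (1 / 6) with hw | hw
  · rw [← QQ_deriv2 c (mem_UU h0 (by linarith))]
    refine (QQ_near2 hc h0 hw).trans ?_
    gcongr
    unfold K2; linarith
  · have him : 1 / 10 ≤ |w.im| := by
      have := Complex.norm_le_abs_re_add_abs_im w
      rw [abs_of_pos h0] at this
      linarith
    have hF := FF_iter_far (w := w) 2 hc (by rw [abs_of_pos h0]; linarith) him
    have hF2 : ‖iteratedDeriv 2 (FF c) w‖ ≤ 800 * KK * (36 * ‖w‖ ^ (-(3 / 2) : ℝ)) := by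
      refine hF.trans ?_
      have e : ((Nat.factorial 2 : ℕ) : ℝ) * (KK / (1 + w.im ^ 2)) / (1 / 20) ^ 2
        = 800 * KK * (1 + w.im ^ 2)⁻¹ := by
        norm_num [Nat.factorial]; field_simp; norm_num
      rw [e]
      gcongr
      refine le_trans ?_ (rpow_aux hw (p := 2) (by norm_num) (by norm_num))
      rw [Real.rpow_neg hwp.le, Real.rpow_two]
      gcongr
      rw [Complex.sq_norm, Complex.normSq_apply]
      nlinarith
    have n3 : ‖w ^ (-((3 : ℝ) : ℂ))‖ ≤ 36 * ‖w‖ ^ (-(3 / 2) : ℝ) := by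
      rw [← Complex.ofReal_neg, Complex.norm_cpow_real]
      exact rpow_aux hw (by norm_num) (by norm_num)
    have n5 : ‖w ^ (-((5 / 2 : ℝ) : ℂ))‖ ≤ 36 * ‖w‖ ^ (-(3 / 2) : ℝ) := by
      rw [← Complex.ofReal_neg, Complex.norm_cpow_real]
      exact rpow_aux hw (by norm_num) (by norm_num)
    refine (norm_sub_le _ _).trans ((add_le_add_left (norm_sub_le _ _) _).trans ?_)
    rw [norm_mul, norm_mul, norm_mul]
    have e2 : ‖(2 : ℂ)‖ = 2 := by simp
    have e34 : ‖(3 / 4 : ℂ)‖ = 3 / 4 := by simp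
    rw [e2, e34]
    have hp : 0 < ‖w‖ ^ (-(3 / 2) : ℝ) := by positivity
    calc _ ≤ 800 * KK * (36 * ‖w‖ ^ (-(3 / 2) : ℝ)) + 2 * (36 * ‖w‖ ^ (-(3 / 2) : ℝ)) +
        1 * (3 / 4) * (36 * ‖w‖ ^ (-(3 / 2) : ℝ)) := by gcongr
      _ ≤ _ := by unfold K2; linarith

lemma Gamma_three : Real.Gamma 3 = 2 := by
  norm_num [Nat.factorial]

lemma Gamma_five_half : Real.Gamma (5 / 2) = 3 / 4 * √Real.pi := by
  have := Real.Gamma_nat_add_half 2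
  norm_num [Nat.doubleFactorial] at this
  rw [this]; ring

lemma main_bound {c : ℂ} (hc : ‖c‖ ≤ 1) : ∃ K : ℝ, ∀ L : ℝ, 20 ≤ L →
    ‖-(1 / (2 * (Real.pi : ℂ))) * (∫ t : ℝ, FF c (1 / 2 + t * Complex.I) *
      Complex.exp ((1 / 2 + t * Complex.I) * L)) -
      (-1 - c * (((Real.pi * L) ^ (-(1 : ℝ) / 2) : ℝ) : ℂ))‖ ≤ K * L ^ (-(3 : ℝ) / 2) := by
  set B : ℝ := ∫ t : ℝ, ‖(1 + t * Complex.I : ℂ)‖ ^ (-(3 / 2) : ℝ) with hB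
  refine ⟨1 / (2 * Real.pi) * (Real.exp 1 * K2 * B), fun L hL => ?_⟩
  have hL0 : 0 < L := by linarith
  have hLc : (L : ℂ) ≠ 0 := by exact_mod_cast hL0.ne'
  have hpi : (Real.pi : ℂ) ≠ 0 := by exact_mod_cast Real.pi_ne_zero
  set a : ℝ := L⁻¹ with ha
  have ha0 : 0 < a := by positivity
  have ha1 : a ≤ 1 / 20 := by
    rw [ha, inv_le_comm₀ hL0 (by norm_num)]; norm_num; exact hL
  have haL : a * L = 1 := by rw [ha]; field_simp
  rw [shift hc ha0 (by linarith) hL0]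
  have b0 := ibp (L := L) 0 hc ha0 (by linarith)
  have b1 := ibp (L := L) 1 hc ha0 (by linarith)
  simp only [iteratedDeriv_zero, zero_add] at b0
  norm_num only at b1
  set I0 := ∫ t : ℝ, FF c (a + t * Complex.I) * Complex.exp ((a + t * Complex.I) * L)
  set I1 := ∫ t : ℝ, iteratedDeriv 1 (FF c) (a + t * Complex.I) * Complex.exp ((a + t * Complex.I) * L)
  have i2 := mul_exp_integrable (FF_line_integrable 2 hc ha0 (by linarith)) a L
  have pint : ∀ s : ℝ, 1 < s → Integrable (fun t : ℝ => (a + t * Complex.I : ℂ) ^ (-(s : ℂ)) *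
      Complex.exp ((a + t * Complex.I) * L)) := by
    intro s hs
    apply mul_exp_integrable
    refine (line_pow_integrable ha0 hs).mono' (cpow_line_continuous ha0 _).aestronglyMeasurable
      (Eventually.of_forall fun t => ?_)
    rw [norm_line_cpow]
  have p3 := pint 3 (by norm_num)
  have p5 := pint (5 / 2) (by norm_num)
  have l3 := inv_laplace (s := 3) (by norm_num) ha0 hL0
  have l5 := inv_laplace (s := 5 / 2) (by norm_num) ha0 hL0
  have hsplit : (∫ t : ℝ, (iteratedDeriv 2 (FF c) (a + t * Complex.I)
      - 2 * (a + t * Complex.I : ℂ) ^ (-((3 : ℝ) : ℂ))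
      - c * (3 / 4) * (a + t * Complex.I : ℂ) ^ (-((5 / 2 : ℝ) : ℂ))) *
        Complex.exp ((a + t * Complex.I) * L)) =
      (∫ t : ℝ, iteratedDeriv 2 (FF c) (a + t * Complex.I) * Complex.exp ((a + t * Complex.I) * L))
      - 2 * (2 * Real.pi * (L ^ ((3 : ℝ) - 1) : ℝ) / (Real.Gamma 3 : ℝ))
      - c * (3 / 4) * (2 * Real.pi * (L ^ ((5 / 2 : ℝ) - 1) : ℝ) / (Real.Gamma (5 / 2) : ℝ)) := by
    rw [← l3, ← l5, ← integral_const_mul, ← integral_const_mul, ← integral_sub i2 (p3.const_mul _)]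
    refine Eq.trans ?_ (integral_sub (i2.sub (p3.const_mul _)) (p5.const_mul _))
    congr 1
    ext t
    ring
  have hbound : ‖∫ t : ℝ, (iteratedDeriv 2 (FF c) (a + t * Complex.I)
      - 2 * (a + t * Complex.I : ℂ) ^ (-((3 : ℝ) : ℂ))
      - c * (3 / 4) * (a + t * Complex.I : ℂ) ^ (-((5 / 2 : ℝ) : ℂ))) *
        Complex.exp ((a + t * Complex.I) * L)‖ ≤ Real.exp 1 * K2 * B * L ^ (1 / 2 : ℝ) := by
    have hi := (line_pow_integrable (s := 3 / 2) ha0 (by norm_num)).const_mul (Real.exp 1 * K2)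
    refine (norm_integral_le_of_norm_le hi (Eventually.of_forall fun t => ?_)).trans (le_of_eq ?_)
    · rw [norm_mul, norm_exp_line, haL]
      have := model_bound (w := a + t * Complex.I) hc (by simpa using ha0) (by simpa using ha1)
      calc _ ≤ (K2 * ‖(a + t * Complex.I : ℂ)‖ ^ (-(3 / 2) : ℝ)) * Real.exp 1 := by gcongr
        _ = _ := by ring
    · rw [integral_const_mul, line_pow_integral ha0, ha, Real.inv_rpow hL0.le,
        ← Real.rpow_neg hL0.le, ← hB]
      norm_num
      ring
  rw [hsplit] at hbound
  set I2 := ∫ t : ℝ, iteratedDeriv 2 (FF c) (a + t * Complex.I) * Complex.exp ((a + t * Complex.I) * L)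
  have hI : I2 = L ^ 2 * I0 := by
    have : I2 = -(L * I1) := by rw [b1]; ring
    rw [this]
    have : I1 = -(L * I0) := by rw [b0]; ring
    rw [this]; ring
  have hpq : (((Real.pi * L) ^ (-(1 : ℝ) / 2) : ℝ) : ℂ) = (L : ℂ)⁻¹ ^ 2 * ((L ^ ((5 / 2 : ℝ) - 1) : ℝ) : ℂ)
      / ((√Real.pi : ℝ) : ℂ) := by
    have : (Real.pi * L) ^ (-(1 : ℝ) / 2) = L⁻¹ ^ 2 * L ^ ((5 / 2 : ℝ) - 1) / √Real.pi := by
      rw [Real.mul_rpow Real.pi_pos.le hL0.le, Real.sqrt_eq_rpow, inv_pow, ← Real.rpow_two,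
        ← Real.rpow_neg hL0.le, ← Real.rpow_add hL0, neg_div, Real.rpow_neg Real.pi_pos.le]
      norm_num
      field_simp
    rw [this]; push_cast; rfl
  have hsq : ((√Real.pi : ℝ) : ℂ) ≠ 0 := by
    exact_mod_cast (Real.sqrt_pos.mpr Real.pi_pos).ne'
  have hfin : -(1 / (2 * (Real.pi : ℂ))) * I0 - (-1 - c * (((Real.pi * L) ^ (-(1 : ℝ) / 2) : ℝ) : ℂ))
      = -(1 / (2 * (Real.pi : ℂ))) * (L : ℂ)⁻¹ ^ 2 * (I2 - 2 * (2 * Real.pi * (L ^ ((3 : ℝ) - 1) : ℝ) / (Real.Gamma 3 : ℝ))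
      - c * (3 / 4) * (2 * Real.pi * (L ^ ((5 / 2 : ℝ) - 1) : ℝ) / (Real.Gamma (5 / 2) : ℝ))) := by
    rw [hI, hpq, Gamma_three, Gamma_five_half, show (3 : ℝ) - 1 = 2 by norm_num, Real.rpow_two]
    push_cast
    field_simp
    ring
  rw [hfin, norm_mul, norm_mul, norm_neg]
  have en : ‖(1 / (2 * (Real.pi : ℂ)))‖ = 1 / (2 * Real.pi) := by
    simp [abs_of_pos Real.pi_pos]
  have en2 : ‖(L : ℂ)⁻¹ ^ 2‖ = L⁻¹ ^ 2 := by
    simp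
  rw [en, en2]
  calc _ ≤ 1 / (2 * Real.pi) * L⁻¹ ^ 2 * (Real.exp 1 * K2 * B * L ^ (1 / 2 : ℝ)) := by gcongr
    _ = 1 / (2 * Real.pi) * (Real.exp 1 * K2 * B) * (L⁻¹ ^ 2 * L ^ (1 / 2 : ℝ)) := by ring
    _ = _ := by
      congr 1
      rw [inv_pow, ← Real.rpow_two, ← Real.rpow_neg hL0.le, ← Real.rpow_add hL0]
      norm_num

lemma main_O {c : ℂ} (hc : ‖c‖ ≤ 1) (E : ℝ → ℂ)
    (hE : ∀ z : ℝ, 0 < z → E z = -(1 / (2 * Real.pi)) * ∫ t : ℝ,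
      Complex.exp (c * (1 / 2 + t * Complex.I) ^ (((1 : ℝ) / 2 : ℝ) : ℂ)) *
        (z : ℂ) ^ ((1 / 2 : ℂ) + t * Complex.I) *
        (↑Real.pi / Complex.sin (↑Real.pi * (1 / 2 + t * Complex.I)))) :
    (fun z : ℝ => E z - (-1 - c * (((Real.pi * Real.log z) ^ (-(1 : ℝ) / 2) : ℝ) : ℂ)))
        =O[atTop] fun z : ℝ => Real.log z ^ (-(3 : ℝ) / 2) := by
  obtain ⟨K, hK⟩ := main_bound hc
  apply IsBigO.of_bound K
  filter_upwards [Real.tendsto_log_atTop.eventually_ge_atTop 20, eventually_gt_atTop 0] with z hz hz0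
  have h := hK _ hz
  have hlog : 0 < Real.log z := by linarith
  rw [Real.norm_of_nonneg (by positivity)]
  rw [hE z hz0]
  refine le_trans (le_of_eq ?_) h
  congr 4
  ext t
  have hzc : (z : ℂ) ≠ 0 := by exact_mod_cast hz0.ne'
  rw [Complex.cpow_def_of_ne_zero hzc, ← Complex.ofReal_log hz0.le, FF]
  push_cast
  ring_nf

/-- Let `E₊` (resp. `E₋`) be the analytic continuation along the positive real axis of
`∑_{n≥1} e^{√n}(−z)^n` (resp. `∑_{n≥1} e^{−√n}(−z)^n`), i.e. of `E(z; ±1, 1/2)`, given for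
`z > 0` by the Lindelöf integral.  Then, as `z → +∞`,
`E(z; 1, 1/2) = −1 − (π log z)^{−1/2} + O((log z)^{−3/2})` and
`E(z; −1, 1/2) = −1 + (π log z)^{−1/2} + O((log z)^{−3/2})`. -/
theorem genExp_sqrt_asymp
    (Eplus Eminus : ℝ → ℂ)
    (hEplus : ∀ z : ℝ, 0 < z → Eplus z = -(1 / (2 * Real.pi)) * ∫ t : ℝ,
      Complex.exp (((1 : ℝ) : ℂ) * (1 / 2 + t * Complex.I) ^ (((1 : ℝ) / 2 : ℝ) : ℂ)) *
        (z : ℂ) ^ ((1 / 2 : ℂ) + t * Complex.I) *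
        (↑Real.pi / Complex.sin (↑Real.pi * (1 / 2 + t * Complex.I))))
    (hEminus : ∀ z : ℝ, 0 < z → Eminus z = -(1 / (2 * Real.pi)) * ∫ t : ℝ,
      Complex.exp (((-1 : ℝ) : ℂ) * (1 / 2 + t * Complex.I) ^ (((1 : ℝ) / 2 : ℝ) : ℂ)) *
        (z : ℂ) ^ ((1 / 2 : ℂ) + t * Complex.I) *
        (↑Real.pi / Complex.sin (↑Real.pi * (1 / 2 + t * Complex.I)))) :
    ((fun z : ℝ => Eplus z - (-1 - (((Real.pi * Real.log z) ^ (-(1 : ℝ) / 2) : ℝ) : ℂ)))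
        =O[atTop] fun z : ℝ => Real.log z ^ (-(3 : ℝ) / 2)) ∧
    ((fun z : ℝ => Eminus z - (-1 + (((Real.pi * Real.log z) ^ (-(1 : ℝ) / 2) : ℝ) : ℂ)))
        =O[atTop] fun z : ℝ => Real.log z ^ (-(3 : ℝ) / 2)) := by

  constructor
  · have := main_O (c := ((1 : ℝ) : ℂ)) (by simp) Eplus hEplus
    simpa using this
  · have := main_O (c := ((-1 : ℝ) : ℂ)) (by simp) Eminus hEminus
    simpa using this
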